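/- arXiv:1403.2557 — 5 statements merged into one kernel-verified Lean document; each statement's English description precedes it below -/
import Mathlib

section
/- Let n ≥ 1 be a natural number, let Q₁, …, Qₙ be K-subspaces of A = K⟨x,y⟩, and let a ∈ A ⊗_K A be such that a ∈ Q_i ⊗ A + A ⊗ Q_j for all 1 ≤ i, j ≤ n. Then a ∈ (⋂_{i=1}^{n} Q_i) ⊗ A + A ⊗ (⋂_{i=1}^{n} Q_i). -/
open TensorProduct

noncomputable section

/-- The free associative unital `K`-algebra on two generators `x, y`. -/
abbrev FA (K : Type) [Field K] : Type := FreeAlgebra K (Fin 2)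

/-- The canonical image of `U ⊗[K] V` inside `A ⊗[K] A`. -/
def tp (K : Type) [Field K] (U V : Submodule K (FA K)) : Submodule K (FA K ⊗[K] FA K) :=
  Submodule.map₂ (TensorProduct.mk K (FA K) (FA K)) U V

open LinearMap in
/-- Over a field, the kernel of `f ⊗ g` is `ker f ⊗ N + M ⊗ ker g`. -/
theorem ker_tensorProduct_map {K M N M' N' : Type*} [Field K]
    [AddCommGroup M] [AddCommGroup N] [AddCommGroup M'] [AddCommGroup N']
    [Module K M] [Module K N] [Module K M'] [Module K N']
    (f : M →ₗ[K] M') (g : N →ₗ[K] N') :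
    ker (TensorProduct.map f g) =
      Submodule.map₂ (TensorProduct.mk K M N) (ker f) ⊤ ⊔
        Submodule.map₂ (TensorProduct.mk K M N) ⊤ (ker g) := by
  have hfg : TensorProduct.map f g =
      TensorProduct.map (range f).subtype (range g).subtype ∘ₗ
        TensorProduct.map f.rangeRestrict g.rangeRestrict := by
    rw [← TensorProduct.map_comp]; rfl
  have hinj : ker (TensorProduct.map (range f).subtype (range g).subtype) = ⊥ :=
    ker_eq_bot.2 <| TensorProduct.map_injective_of_flat_flat _ _
      (range f).subtype_injective (range g).subtype_injective
  have hf : Function.Exact (ker f).subtype f.rangeRestrict :=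
    LinearMap.exact_iff.2 <| by rw [ker_rangeRestrict, Submodule.range_subtype]
  have hg : Function.Exact (ker g).subtype g.rangeRestrict :=
    LinearMap.exact_iff.2 <| by rw [ker_rangeRestrict, Submodule.range_subtype]
  rw [hfg, ker_comp, hinj, Submodule.comap_bot,
    TensorProduct.map_ker hf f.surjective_rangeRestrict
      hg g.surjective_rangeRestrict, sup_comm]
  simp only [lTensor, rTensor, TensorProduct.range_map, Submodule.range_subtype, range_id]

/-- A tensor in a product of two finite products vanishes if all its components do. -/
theorem tensorProduct_pi_eq_zero {R ι κ : Type*} [CommSemiring R] [Fintype ι] [Fintype κ]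
    {M : ι → Type*} {N : κ → Type*} [∀ i, AddCommMonoid (M i)] [∀ j, AddCommMonoid (N j)]
    [∀ i, Module R (M i)] [∀ j, Module R (N j)] (z : (∀ i, M i) ⊗[R] (∀ j, N j))
    (h : ∀ i j, TensorProduct.map (LinearMap.proj i : _ →ₗ[R] M i)
      (LinearMap.proj j : _ →ₗ[R] N j) z = 0) : z = 0 := by
  classical
  have hid : (∑ i, ∑ j, TensorProduct.map (LinearMap.single R M i) (LinearMap.single R N j) ∘ₗ
      TensorProduct.map (LinearMap.proj i) (LinearMap.proj j)) = LinearMap.id := by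
    refine TensorProduct.ext' fun u v => ?_
    simp only [LinearMap.sum_apply, LinearMap.comp_apply, TensorProduct.map_tmul,
      LinearMap.proj_apply, LinearMap.single_apply, LinearMap.id_apply,
      ← TensorProduct.tmul_sum, ← TensorProduct.sum_tmul, LinearMap.sum_single_apply]
  rw [← LinearMap.id_apply (R := R) z, ← hid]
  simp [LinearMap.sum_apply, h]

/-- If `a ∈ Q_i ⊗ A + A ⊗ Q_j` for all `i, j` then
`a ∈ (⋂ Q_i) ⊗ A + A ⊗ (⋂ Q_i)`. -/
theorem statement2 (K : Type) [Field K] (n : ℕ) (hn : 1 ≤ n)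
    (Q : Fin n → Submodule K (FA K)) (a : FA K ⊗[K] FA K)
    (h : ∀ i j : Fin n, a ∈ tp K (Q i) ⊤ ⊔ tp K ⊤ (Q j)) :
    a ∈ tp K (⨅ i, Q i) ⊤ ⊔ tp K ⊤ (⨅ i, Q i) := by
  have hker : LinearMap.ker (LinearMap.pi fun i => (Q i).mkQ) = ⨅ i, Q i := by
    simp [LinearMap.ker_pi]
  unfold tp at h ⊢
  rw [← hker, ← ker_tensorProduct_map, LinearMap.mem_ker]
  refine tensorProduct_pi_eq_zero _ fun i j => ?_
  rw [← LinearMap.comp_apply, ← TensorProduct.map_comp, LinearMap.proj_pi, LinearMap.proj_pi,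
    ← LinearMap.mem_ker, ker_tensorProduct_map, Submodule.ker_mkQ, Submodule.ker_mkQ]
  exact h i j
end
end

section
/- There exist natural numbers 0 < a₁ < a₂ < a₃ < … such that 200·(i+1)²·a_i divides a_{i+1} for every i ≥ 1, with the following property (setting a₀ = 0): whenever I is a two-sided ideal of A = K⟨x,y⟩ generated by homogeneous elements, each generator having degree d satisfying a_n/(40n) < d ≤ 20·n·a_n for some n ≥ 1, and such that for every n ≥ 1 the number of generators with degree in the interval (a_n/(40n), 20·n·a_n] is at most 2^{510·n·a_{n−1}}·a_{n+2}^{110·n}, the quotient algebra A/I is infinite-dimensional over K. -/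
open TensorProduct

noncomputable section

/-- `gp K n` is `A(n)`, the span of the words of length `n` in the two generators. -/
def gp (K : Type) [Field K] (n : ℕ) : Submodule K (FA K) :=
  Submodule.span K {a : FA K | ∃ w : List (Fin 2), w.length = n ∧ a = (w.map (FreeAlgebra.ι K)).prod}

/-- The quotient of `A` by the two-sided ideal generated by the set `S`. -/
abbrev quotBy (K : Type) [Field K] (S : Set (FA K)) : Type :=
  RingQuot (fun a b : FA K => a ∈ S ∧ b = 0)

/-- The generators of `S` which are homogeneous of a degree `d` with
`a n / (40 n) < d ≤ 20 n (a n)`. -/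
def gensIn (K : Type) [Field K] (a : ℕ → ℕ) (S : Set (FA K)) (n : ℕ) : Set (FA K) :=
  {s ∈ S | ∃ d : ℕ, s ∈ gp K d ∧ a n < 40 * n * d ∧ d ≤ 20 * n * a n}

open Module

theorem basisFreeMonoid_eq_prod (K : Type) [Field K] (w : List (Fin 2)) :
    FreeAlgebra.basisFreeMonoid K (Fin 2) (FreeMonoid.ofList w) =
      (w.map (FreeAlgebra.ι K)).prod := by
  simp [FreeAlgebra.basisFreeMonoid, FreeAlgebra.equivMonoidAlgebraFreeMonoid, FreeMonoid.lift_apply]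

theorem gp_zero (K : Type) [Field K] : gp K 0 = 1 := by
  rw [Submodule.one_eq_span, gp]
  congr 1
  ext a
  simp

theorem gp_add (K : Type) [Field K] (m n : ℕ) : gp K (m + n) = gp K m * gp K n := by
  rw [gp, gp, gp, Submodule.span_mul_span]
  congr 1
  ext a
  rw [Set.mem_mul]
  constructor
  · rintro ⟨w, hw, rfl⟩
    refine ⟨_, ⟨w.take m, by simp; omega, rfl⟩, _, ⟨w.drop m, by simp; omega, rfl⟩, ?_⟩
    rw [← List.prod_append, ← List.map_append, List.take_append_drop]
  · rintro ⟨_, ⟨u, hu, rfl⟩, _, ⟨v, hv, rfl⟩, rfl⟩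
    exact ⟨u ++ v, by simp [hu, hv], by simp⟩

theorem gp_eq_span_range (K : Type) [Field K] (n : ℕ) :
    gp K n = Submodule.span K (Set.range fun w : List.Vector (Fin 2) n =>
      (w.toList.map (FreeAlgebra.ι K)).prod) := by
  rw [gp]
  congr 1
  ext a
  constructor
  · rintro ⟨w, hw, rfl⟩
    exact ⟨⟨w, hw⟩, rfl⟩
  · rintro ⟨w, rfl⟩
    exact ⟨w.toList, w.toList_length, rfl⟩

instance finiteDimensional_gp (K : Type) [Field K] (n : ℕ) : FiniteDimensional K (gp K n) := by
  rw [gp_eq_span_range]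
  exact FiniteDimensional.span_of_finite K (Set.finite_range _)

theorem finrank_gp (K : Type) [Field K] (n : ℕ) : finrank K (gp K n) = 2 ^ n := by
  rw [gp_eq_span_range, finrank_span_eq_card]
  · simp
  · have h := (FreeAlgebra.basisFreeMonoid K (Fin 2)).linearIndependent.comp
      (fun w : List.Vector (Fin 2) n => FreeMonoid.ofList w.toList)
      (fun u v huv => List.Vector.eq _ _ (FreeMonoid.ofList.injective huv))
    convert! h using 2 with w
    simp [basisFreeMonoid_eq_prod]

/-- The projection of `A` onto its homogeneous component of degree `n`. -/
def homogeneousProj (K : Type) [Field K] (n : ℕ) : FA K →ₗ[K] FA K :=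
  (FreeAlgebra.basisFreeMonoid K (Fin 2)).constr K fun w =>
    if w.toList.length = n then (w.toList.map (FreeAlgebra.ι K)).prod else 0

theorem homogeneousProj_of_mem (K : Type) [Field K] {m : ℕ} (n : ℕ) {x : FA K}
    (hx : x ∈ gp K m) : homogeneousProj K n x = if m = n then x else 0 := by
  induction hx using Submodule.span_induction with
  | mem x hx =>
    obtain ⟨w, hw, rfl⟩ := hx
    rw [← basisFreeMonoid_eq_prod, homogeneousProj, Basis.constr_basis]
    simp [hw, basisFreeMonoid_eq_prod]
  | zero => simp
  | add x y _ _ hx hy => rw [map_add, hx, hy]; split_ifs <;> simp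
  | smul c x _ hx => rw [map_smul, hx]; split_ifs <;> simp

/-- The degree `n` part of the two-sided ideal generated by the sets `R d`, the elements of
`R d` being regarded as homogeneous of degree `d + 1`. -/
def relPart (K : Type) [Field K] (R : ℕ → Set (FA K)) (n : ℕ) : Submodule K (FA K) :=
  Submodule.span K {z | ∃ i d j, i + (d + 1) + j = n ∧
    ∃ u ∈ gp K i, ∃ r ∈ R d, ∃ v ∈ gp K j, z = u * r * v}

section relPart

variable {K : Type} [Field K] {R : ℕ → Set (FA K)}

theorem relPart_zero : relPart K R 0 = ⊥ := by
  rw [relPart, Submodule.span_eq_bot]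
  rintro z ⟨i, d, j, h, -⟩
  omega

theorem relPart_le (hR : ∀ d, R d ⊆ gp K (d + 1)) (n : ℕ) : relPart K R n ≤ gp K n := by
  refine Submodule.span_le.2 ?_
  rintro z ⟨i, d, j, rfl, u, hu, r, hr, v, hv, rfl⟩
  rw [SetLike.mem_coe, gp_add, gp_add]
  exact Submodule.mul_mem_mul (Submodule.mul_mem_mul hu (hR d hr)) hv

theorem relPart_mul_gp_le (m n : ℕ) : relPart K R m * gp K n ≤ relPart K R (m + n) := by
  rw [← Submodule.span_eq (gp K n), relPart, Submodule.span_mul_span, Submodule.span_le]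
  rintro _ ⟨_, ⟨i, d, j, rfl, u, hu, r, hr, v, hv, rfl⟩, w, hw, rfl⟩
  refine Submodule.subset_span ⟨i, d, j + n, by omega, u, hu, r, hr, v * w, ?_, by
    simp only [mul_assoc]⟩
  rw [gp_add]
  exact Submodule.mul_mem_mul hv hw

theorem gp_mul_relPart_le (m n : ℕ) : gp K m * relPart K R n ≤ relPart K R (m + n) := by
  rw [← Submodule.span_eq (gp K m), relPart, Submodule.span_mul_span, Submodule.span_le]
  rintro _ ⟨w, hw, _, ⟨i, d, j, rfl, u, hu, r, hr, v, hv, rfl⟩, rfl⟩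
  refine Submodule.subset_span ⟨m + i, d, j, by omega, w * u, ?_, r, hr, v, hv, by
    simp only [mul_assoc]⟩
  rw [gp_add]
  exact Submodule.mul_mem_mul hw hu

theorem finrank_mul_le (M N : Submodule K (FA K)) [FiniteDimensional K M]
    [FiniteDimensional K N] : finrank K (M * N : Submodule K (FA K)) ≤
      finrank K M * finrank K N := by
  rw [← Submodule.mulMap_range, ← finrank_tensorProduct]
  exact LinearMap.finrank_range_le _

instance finiteDimensional_mul (M N : Submodule K (FA K)) [FiniteDimensional K M]
    [FiniteDimensional K N] : FiniteDimensional K (M * N : Submodule K (FA K)) := by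
  rw [← Submodule.mulMap_range]
  infer_instance

theorem finrank_finset_sup_le {ι : Type} (s : Finset ι) (f : ι → Submodule K (FA K))
    [∀ i, FiniteDimensional K (f i)] :
    finrank K (s.sup f : Submodule K (FA K)) ≤ ∑ i ∈ s, finrank K (f i) := by
  classical
  induction s using Finset.induction_on with
  | empty => simp
  | insert a s ha ih =>
    rw [Finset.sup_insert, Finset.sum_insert ha]
    exact (Submodule.finrank_add_le_finrank_add_finrank _ _).trans (by gcongr)

theorem relPart_succ_le (hR : ∀ d, R d ⊆ gp K (d + 1)) (W : ℕ → Submodule K (FA K))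
    (hW : ∀ n, relPart K R n ⊔ W n = gp K n) (n : ℕ) :
    relPart K R (n + 1) ≤ relPart K R n * gp K 1 ⊔
      (Finset.range (n + 1)).sup fun d => W (n - d) * Submodule.span K (R d) := by
  refine Submodule.span_le.2 ?_
  rintro z ⟨i, d, j, hn, u, hu, r, hr, v, hv, rfl⟩
  rw [SetLike.mem_coe]
  rcases j with _ | j
  · have hmem : u * r ∈ relPart K R n * gp K 1 ⊔
        (Finset.range (n + 1)).sup fun d => W (n - d) * Submodule.span K (R d) := by
      obtain rfl : i = n - d := by omega
      rw [← hW, Submodule.mem_sup] at hu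
      obtain ⟨a, ha, b, hb, rfl⟩ := hu
      rw [add_mul]
      refine Submodule.add_mem_sup ?_ ?_
      · have h1 : a * r ∈ relPart K R (n - d) * gp K d * gp K 1 := by
          rw [mul_assoc, ← gp_add]
          exact Submodule.mul_mem_mul ha (hR d hr)
        have h2 := relPart_mul_gp_le (K := K) (R := R) (n - d) d
        rw [Nat.sub_add_cancel (by omega)] at h2
        exact mul_le_mul' h2 le_rfl h1
      · have hd : d ∈ Finset.range (n + 1) := Finset.mem_range.2 (by omega)
        exact Finset.le_sup (f := fun d => W (n - d) * Submodule.span K (R d)) hd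
          (Submodule.mul_mem_mul hb (Submodule.subset_span hr))
    rw [gp_zero, Submodule.mem_one] at hv
    obtain ⟨c, rfl⟩ := hv
    rw [← Algebra.commutes, ← Algebra.smul_def]
    exact Submodule.smul_mem _ _ hmem
  · refine Submodule.mem_sup_left ?_
    have h1 : u * r * v ∈ relPart K R n * gp K 1 := by
      rw [gp_add] at hv
      induction hv using Submodule.mul_induction_on' with
      | mem_mul_mem a ha b hb =>
        rw [← mul_assoc]
        exact Submodule.mul_mem_mul
          (Submodule.subset_span ⟨i, d, j, by omega, u, hu, r, hr, a, ha, rfl⟩) hb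
      | add x _ y _ hx hy => rw [mul_add]; exact add_mem hx hy
    exact h1

theorem exists_compl_relPart (hR : ∀ d, R d ⊆ gp K (d + 1)) (n : ℕ) :
    ∃ W : Submodule K (FA K), W ≤ gp K n ∧ relPart K R n ⊔ W = gp K n ∧
      finrank K (relPart K R n) + finrank K W = 2 ^ n := by
  obtain ⟨W, hd, hs⟩ := IsModularLattice.exists_disjoint_and_sup_eq (relPart_le hR n)
  have hW : W ≤ gp K n := hs ▸ le_sup_right
  have := Submodule.finiteDimensional_of_le (relPart_le hR n)
  have := Submodule.finiteDimensional_of_le hW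
  refine ⟨W, hW, hs, ?_⟩
  rw [← finrank_gp K n, ← hs, ← Submodule.finrank_sup_add_finrank_inf_eq, hd.eq_bot, finrank_bot,
    add_zero]

/-- The Golod–Shafarevich inequality between the dimensions of the homogeneous components of
the quotient by the ideal generated by the `R d`. -/
theorem golod_shafarevich_recurrence (hR : ∀ d, R d ⊆ gp K (d + 1)) (hfin : ∀ d, (R d).Finite)
    (n : ℕ) :
    2 * ((2 : ℝ) ^ n - finrank K (relPart K R n)) ≤
      ((2 : ℝ) ^ (n + 1) - finrank K (relPart K R (n + 1))) +
        ∑ d ∈ Finset.range (n + 1),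
          ((2 : ℝ) ^ (n - d) - finrank K (relPart K R (n - d))) * (R d).ncard := by
  choose W hWle hW hdim using exists_compl_relPart hR
  have hWfin (m : ℕ) : FiniteDimensional K (W m) := Submodule.finiteDimensional_of_le (hWle m)
  have hJfin (m : ℕ) : FiniteDimensional K (relPart K R m) :=
    Submodule.finiteDimensional_of_le (relPart_le hR m)
  have hspan (d : ℕ) : FiniteDimensional K (Submodule.span K (R d)) :=
    FiniteDimensional.span_of_finite K (hfin d)
  have hcard (d : ℕ) : finrank K (Submodule.span K (R d)) ≤ (R d).ncard := by
    have := (hfin d).fintype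
    rw [Set.ncard_eq_toFinset_card']
    exact finrank_span_le_card (R d)
  have hWdim (m : ℕ) : (2 : ℝ) ^ m - finrank K (relPart K R m) = finrank K (W m) := by
    rw [sub_eq_iff_eq_add']
    exact_mod_cast (hdim m).symm
  have key : finrank K (relPart K R (n + 1)) ≤ finrank K (relPart K R n) * 2 +
      ∑ d ∈ Finset.range (n + 1), finrank K (W (n - d)) * (R d).ncard := by
    refine (Submodule.finrank_mono (relPart_succ_le hR W hW n)).trans
      ((Submodule.finrank_add_le_finrank_add_finrank _ _).trans (add_le_add ?_ ?_))
    · simpa [finrank_gp] using finrank_mul_le (relPart K R n) (gp K 1)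
    · refine (finrank_finset_sup_le _ _).trans (Finset.sum_le_sum fun d _ => ?_)
      exact (finrank_mul_le _ _).trans (Nat.mul_le_mul_left _ (hcard d))
  have key' : (finrank K (relPart K R (n + 1)) : ℝ) ≤ finrank K (relPart K R n) * 2 +
      ∑ d ∈ Finset.range (n + 1), (finrank K (W (n - d)) : ℝ) * (R d).ncard := by
    exact_mod_cast key
  simp_rw [hWdim (n - _)]
  rw [pow_succ]
  linarith

/-- A sequence satisfying a Golod–Shafarevich recurrence grows exponentially if the numbers of
relations are small. -/
theorem pos_of_golod_shafarevich {w r : ℕ → ℝ} {c : ℝ} (hc : 0 < c) (hr : ∀ d, 0 ≤ r d)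
    (hw0 : 0 < w 0)
    (hrec : ∀ n, 2 * w n ≤ w (n + 1) + ∑ d ∈ Finset.range (n + 1), w (n - d) * r d)
    (hsum : ∀ N, ∑ d ∈ Finset.range N, r d / c ^ d ≤ 2 - c) (n : ℕ) : 0 < w n := by
  suffices h : ∀ n, 0 < w n ∧ ∀ d ≤ n, c ^ d * w (n - d) ≤ w n from (h n).1
  intro n
  induction n with
  | zero =>
    refine ⟨hw0, fun d hd => ?_⟩
    obtain rfl : d = 0 := by omega
    simp
  | succ n ih =>
    obtain ⟨hpos, hle⟩ := ih
    have hbound : ∑ d ∈ Finset.range (n + 1), w (n - d) * r d ≤ (2 - c) * w n := by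
      calc ∑ d ∈ Finset.range (n + 1), w (n - d) * r d
          ≤ ∑ d ∈ Finset.range (n + 1), r d / c ^ d * w n := by
            refine Finset.sum_le_sum fun d hd => ?_
            have h1 := hle d (by simpa [Nat.lt_succ_iff] using hd)
            have hcd : 0 < c ^ d := pow_pos hc d
            rw [div_mul_eq_mul_div, le_div_iff₀ hcd]
            nlinarith [mul_le_mul_of_nonneg_left h1 (hr d)]
        _ ≤ (2 - c) * w n := by
            rw [← Finset.sum_mul]
            exact mul_le_mul_of_nonneg_right (hsum _) hpos.le
    have hstep : c * w n ≤ w (n + 1) := by linarith [hrec n]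
    refine ⟨(mul_pos hc hpos).trans_le hstep, fun d hd => ?_⟩
    rcases d with _ | d
    · simp
    · rw [Nat.add_sub_add_right, pow_succ', mul_assoc]
      exact (mul_le_mul_of_nonneg_left (hle d (by omega)) hc.le).trans hstep

theorem relPart_lt (hR : ∀ d, R d ⊆ gp K (d + 1)) (hfin : ∀ d, (R d).Finite) {c : ℝ}
    (hc : 0 < c) (hsum : ∀ N, ∑ d ∈ Finset.range N, ((R d).ncard : ℝ) / c ^ d ≤ 2 - c) (n : ℕ) :
    relPart K R n < gp K n := by
  refine lt_of_le_of_ne (relPart_le hR n) fun h => ?_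
  have := pos_of_golod_shafarevich (w := fun n => (2 : ℝ) ^ n - finrank K (relPart K R n)) hc
    (fun d => Nat.cast_nonneg (R d).ncard) (by rw [relPart_zero, finrank_bot]; simp)
    (golod_shafarevich_recurrence hR hfin) hsum n
  rw [h, finrank_gp] at this
  simp at this

theorem iSup_gp (K : Type) [Field K] : ⨆ n, gp K n = ⊤ := by
  rw [eq_top_iff, ← (FreeAlgebra.basisFreeMonoid K (Fin 2)).span_eq, Submodule.span_le]
  rintro _ ⟨w, rfl⟩
  refine Submodule.mem_iSup_of_mem w.toList.length (Submodule.subset_span ⟨w.toList, rfl, ?_⟩)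
  exact basisFreeMonoid_eq_prod K w.toList

theorem mul_mem_iSup_relPart (a : FA K) {x : FA K} (hx : x ∈ ⨆ n, relPart K R n) :
    a * x ∈ ⨆ n, relPart K R n := by
  have h : (⨆ m, gp K m) * ⨆ n, relPart K R n ≤ ⨆ n, relPart K R n := by
    rw [Submodule.iSup_mul]
    refine iSup_le fun m => ?_
    rw [Submodule.mul_iSup]
    exact iSup_le fun n => (gp_mul_relPart_le m n).trans (le_iSup (relPart K R) (m + n))
  rw [iSup_gp] at h
  exact h (Submodule.mul_mem_mul Submodule.mem_top hx)

theorem iSup_relPart_mul_mem {x : FA K} (a : FA K) (hx : x ∈ ⨆ n, relPart K R n) :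
    x * a ∈ ⨆ n, relPart K R n := by
  have h : (⨆ n, relPart K R n) * ⨆ m, gp K m ≤ ⨆ n, relPart K R n := by
    rw [Submodule.iSup_mul]
    refine iSup_le fun n => ?_
    rw [Submodule.mul_iSup]
    exact iSup_le fun m => (relPart_mul_gp_le n m).trans (le_iSup (relPart K R) (n + m))
  rw [iSup_gp] at h
  exact h (Submodule.mul_mem_mul hx Submodule.mem_top)

/-- The two-sided ideal generated by the sets `R d`. -/
def relIdeal (K : Type) [Field K] (R : ℕ → Set (FA K)) : Ideal (FA K) where
  carrier := {x | x ∈ ⨆ n, relPart K R n}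
  add_mem' hx hy := (⨆ n, relPart K R n).add_mem hx hy
  zero_mem' := (⨆ n, relPart K R n).zero_mem
  smul_mem' := mul_mem_iSup_relPart

theorem mem_relIdeal {x : FA K} : x ∈ relIdeal K R ↔ x ∈ ⨆ n, relPart K R n := Iff.rfl

instance isTwoSided_relIdeal : (relIdeal K R).IsTwoSided where
  mul_mem_of_left := iSup_relPart_mul_mem

theorem mem_relIdeal_of_mem {d : ℕ} {s : FA K} (hs : s ∈ R d) : s ∈ relIdeal K R :=
  Submodule.mem_iSup_of_mem (d + 1) <| Submodule.subset_span
    ⟨0, d, 0, by omega, 1, by simp [gp_zero], s, hs, 1, by simp [gp_zero], by simp⟩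

theorem homogeneousProj_mem_relPart (hR : ∀ d, R d ⊆ gp K (d + 1)) (n : ℕ) {x : FA K}
    (hx : x ∈ relIdeal K R) : homogeneousProj K n x ∈ relPart K R n := by
  rw [mem_relIdeal] at hx
  induction hx using Submodule.iSup_induction' with
  | mem m x hx =>
    rw [homogeneousProj_of_mem K n (relPart_le hR m hx)]
    split_ifs with h
    · exact h ▸ hx
    · exact zero_mem _
  | zero => simp
  | add x y _ _ hx hy => rw [map_add]; exact add_mem hx hy

theorem not_finite_quotient_relIdeal (hR : ∀ d, R d ⊆ gp K (d + 1))
    (hlt : ∀ n, relPart K R n < gp K n) : ¬ Module.Finite K (FA K ⧸ relIdeal K R) := by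
  intro hfin
  choose _ x hx hx' using fun n => SetLike.lt_iff_le_and_exists.1 (hlt n)
  have hli : LinearIndependent K fun n => Ideal.Quotient.mkₐ K (relIdeal K R) (x n) := by
    rw [linearIndependent_iff']
    intro s g hg n hn
    by_contra hgn
    simp_rw [← map_smul, ← map_sum, Ideal.Quotient.mkₐ_eq_mk, Ideal.Quotient.eq_zero_iff_mem]
      at hg
    have h := homogeneousProj_mem_relPart hR n hg
    simp only [map_sum, map_smul, fun m => homogeneousProj_of_mem K n (hx m), smul_ite,
      smul_zero, Finset.sum_ite_eq', hn, if_true] at h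
    exact hx' n ((Submodule.smul_mem_iff _ hgn).1 h)
  have := hli.finite
  exact not_finite ℕ

theorem not_finite_quotBy {S : Set (FA K)} (hS : ∀ s ∈ S, ∃ d, s ∈ R d)
    (hR : ∀ d, R d ⊆ gp K (d + 1)) (hfin : ∀ d, (R d).Finite) {c : ℝ} (hc : 0 < c)
    (hsum : ∀ N, ∑ d ∈ Finset.range N, ((R d).ncard : ℝ) / c ^ d ≤ 2 - c) :
    ¬ Module.Finite K (quotBy K S) := by
  intro h
  refine not_finite_quotient_relIdeal hR (relPart_lt hR hfin hc hsum) ?_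
  let f : quotBy K S →ₐ[K] FA K ⧸ relIdeal K R :=
    RingQuot.liftAlgHom K ⟨Ideal.Quotient.mkₐ K (relIdeal K R), by
      rintro s _ ⟨hs, rfl⟩
      obtain ⟨d, hd⟩ := hS s hs
      rw [map_zero]
      exact Ideal.Quotient.eq_zero_iff_mem.2 (mem_relIdeal_of_mem hd)⟩
  refine Module.Finite.of_surjective f.toLinearMap fun y => ?_
  obtain ⟨a, rfl⟩ := Ideal.Quotient.mkₐ_surjective K (relIdeal K R) y
  exact ⟨RingQuot.mkAlgHom K _ a, RingQuot.liftAlgHom_mkAlgHom_apply K _ _ a⟩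

end relPart

/-- The sequence `aₙ = Cⁿ (n!)²` with `C = 200 · 2³⁰`, for `n ≥ 1`, and `a₀ = 0`. -/
def sparseSeq (n : ℕ) : ℕ := if n = 0 then 0 else (200 * 2 ^ 30) ^ n * n.factorial ^ 2

theorem sparseSeq_of_pos {n : ℕ} (hn : 1 ≤ n) :
    sparseSeq n = (200 * 2 ^ 30) ^ n * n.factorial ^ 2 := if_neg (by omega)

theorem sparseSeq_succ {n : ℕ} (hn : 1 ≤ n) :
    sparseSeq (n + 1) = 200 * (n + 1) ^ 2 * sparseSeq n * 2 ^ 30 := by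
  rw [sparseSeq_of_pos hn, sparseSeq_of_pos (by omega), Nat.factorial_succ]
  ring

theorem sparseSeq_pos {n : ℕ} (hn : 1 ≤ n) : 0 < sparseSeq n := by
  rw [sparseSeq_of_pos hn]
  positivity

theorem sparseSeq_le_sub_one {n : ℕ} (hn : 1 ≤ n) :
    200 * 2 ^ 30 * n ^ 2 * sparseSeq (n - 1) ≤ sparseSeq n := by
  obtain ⟨m, rfl⟩ : ∃ m, n = m + 1 := ⟨n - 1, by omega⟩
  rcases m with _ | m
  · simp [sparseSeq]
  · rw [Nat.add_sub_cancel, sparseSeq_succ (n := m + 1) (by omega)]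
    exact le_of_eq (by ring)

theorem sparseSeq_add_two_le {n : ℕ} (hn : 1 ≤ n) : sparseSeq (n + 2) ≤ 2 ^ (132 * n ^ 2) := by
  have hfac : (n + 2).factorial ≤ 2 ^ (n + 2) ^ 2 := by
    calc (n + 2).factorial ≤ (n + 2) ^ (n + 2) := Nat.factorial_le_pow _
      _ ≤ (2 ^ (n + 2)) ^ (n + 2) := Nat.pow_le_pow_left Nat.lt_two_pow_self.le _
      _ = 2 ^ (n + 2) ^ 2 := by rw [← pow_mul, sq]
  rw [sparseSeq_of_pos (by omega)]
  calc (200 * 2 ^ 30) ^ (n + 2) * (n + 2).factorial ^ 2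
      ≤ (2 ^ 38) ^ (n + 2) * (2 ^ (n + 2) ^ 2) ^ 2 := by gcongr; norm_num
    _ = 2 ^ (38 * (n + 2) + (n + 2) ^ 2 * 2) := by rw [← pow_mul, ← pow_mul, ← pow_add]
    _ ≤ 2 ^ (132 * n ^ 2) := Nat.pow_le_pow_right (by norm_num) (by nlinarith)

theorem pow_four_le_sparseSeq {n : ℕ} (hn : 1 ≤ n) : 10 * 2 ^ 30 * n ^ 4 ≤ sparseSeq n := by
  obtain ⟨m, rfl⟩ : ∃ m, n = m + 1 := ⟨n - 1, by omega⟩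
  have h : m + 1 ≤ 2 ^ m := Nat.lt_two_pow_self
  rw [sparseSeq_of_pos hn]
  calc 10 * 2 ^ 30 * (m + 1) ^ 4 ≤ 200 * 2 ^ 30 * (2 ^ m) ^ 4 := by gcongr; norm_num
    _ = (2 ^ 4) ^ m * (200 * 2 ^ 30) := by rw [← pow_mul, ← pow_mul]; ring
    _ ≤ (200 * 2 ^ 30) ^ m * (200 * 2 ^ 30) := by gcongr; norm_num
    _ = (200 * 2 ^ 30) ^ (m + 1) * 1 := by ring
    _ ≤ _ := Nat.mul_le_mul_left _ (Nat.one_le_pow _ _ (Nat.factorial_pos _))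

theorem relations_bound {n d : ℕ} (hn : 1 ≤ n) (hd : sparseSeq n < 40 * n * d) :
    ((2 ^ (510 * n * sparseSeq (n - 1)) * sparseSeq (n + 2) ^ (110 * n) : ℕ) : ℝ) ≤
      (9 / 8) ^ d / 16 := by
  set E := 510 * n * sparseSeq (n - 1) + 132 * n ^ 2 * (110 * n) with hE
  have hle : 2 ^ (510 * n * sparseSeq (n - 1)) * sparseSeq (n + 2) ^ (110 * n) ≤ 2 ^ E := by
    rw [hE, pow_add, pow_mul 2 (132 * n ^ 2)]
    exact Nat.mul_le_mul_left _ (Nat.pow_le_pow_left (sparseSeq_add_two_le hn) _)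
  have hEd : 10 * (E + 4) ≤ d := by
    have h1 := sparseSeq_le_sub_one hn
    have h2 := pow_four_le_sparseSeq hn
    have h3 : n ≤ n ^ 4 := Nat.le_self_pow (by norm_num) n
    have h4 : 40 * n * (10 * (E + 4)) ≤ 40 * n * d := by
      refine le_trans ?_ hd.le
      have : 40 * n * (10 * (E + 4)) =
        204000 * (n ^ 2 * sparseSeq (n - 1)) + 5808000 * n ^ 4 + 1600 * n := by
        rw [hE]; ring
      rw [this]
      rw [mul_assoc] at h1
      omega
    exact Nat.le_of_mul_le_mul_left h4 (by omega)
  calc ((2 ^ (510 * n * sparseSeq (n - 1)) * sparseSeq (n + 2) ^ (110 * n) : ℕ) : ℝ)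
      ≤ ((2 ^ E : ℕ) : ℝ) := by exact_mod_cast hle
    _ = 2 ^ (E + 4) / 16 := by rw [pow_add 2 E 4]; push_cast; ring
    _ ≤ ((9 / 8) ^ 10) ^ (E + 4) / 16 := by gcongr; norm_num
    _ = (9 / 8) ^ (10 * (E + 4)) / 16 := by rw [← pow_mul]
    _ ≤ (9 / 8) ^ d / 16 := by gcongr; norm_num

/-- There are `0 < a₁ < a₂ < ⋯` with `200 (i+1)² aᵢ ∣ a_{i+1}` such that any ideal
generated by homogeneous elements of degrees in intervals `(aₙ/(40n), 20 n aₙ]`,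
at most `2^{510 n a_{n-1}} a_{n+2}^{110 n}` of them in each such interval, has
infinite-dimensional quotient. -/
theorem statement4 (K : Type) [Field K] :
    ∃ a : ℕ → ℕ, a 0 = 0 ∧
      (∀ i, 1 ≤ i → 0 < a i) ∧
      (∀ i, 1 ≤ i → a i < a (i + 1)) ∧
      (∀ i, 1 ≤ i → 200 * (i + 1) ^ 2 * a i ∣ a (i + 1)) ∧
      ∀ S : Set (FA K),
        (∀ s ∈ S, ∃ n : ℕ, 1 ≤ n ∧ ∃ d : ℕ, s ∈ gp K d ∧
            a n < 40 * n * d ∧ d ≤ 20 * n * a n) →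
        (∀ n : ℕ, 1 ≤ n → (gensIn K a S n).Finite ∧
            (gensIn K a S n).ncard ≤ 2 ^ (510 * n * a (n - 1)) * a (n + 2) ^ (110 * n)) →
        ¬ Module.Finite K (quotBy K S) := by
  refine ⟨sparseSeq, rfl, fun i hi => sparseSeq_pos hi, fun i hi => ?_, fun i hi => ?_,
    fun S hS hcard => ?_⟩
  · rw [sparseSeq_succ hi]
    nlinarith [sparseSeq_pos hi, Nat.zero_le (i ^ 2 * sparseSeq i), Nat.zero_le (i * sparseSeq i)]
  · rw [sparseSeq_succ hi]
    exact dvd_mul_right _ _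
  let R : ℕ → Set (FA K) := fun d => {s ∈ S | s ∈ gp K (d + 1) ∧
    ∃ n, 1 ≤ n ∧ sparseSeq n < 40 * n * (d + 1) ∧ d + 1 ≤ 20 * n * sparseSeq n}
  have hsub (d : ℕ) : R d = ∅ ∨ ∃ n, 1 ≤ n ∧ sparseSeq n < 40 * n * (d + 1) ∧
      R d ⊆ gensIn K sparseSeq S n := by
    rcases Set.eq_empty_or_nonempty (R d) with h | ⟨s, -, -, n, hn, h1, h2⟩
    · exact Or.inl h
    · exact Or.inr ⟨n, hn, h1, fun t ht => ⟨ht.1, d + 1, ht.2.1, h1, h2⟩⟩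
  have hfin (d : ℕ) : (R d).Finite := by
    rcases hsub d with h | ⟨n, hn, -, h⟩
    · rw [h]
      exact Set.finite_empty
    · exact (hcard n hn).1.subset h
  have hbound (d : ℕ) : ((R d).ncard : ℝ) ≤ (9 / 8) ^ (d + 1) / 16 := by
    rcases hsub d with h | ⟨n, hn, h1, h⟩
    · rw [h, Set.ncard_empty, Nat.cast_zero]
      positivity
    · refine le_trans ?_ (relations_bound hn h1)
      exact_mod_cast (Set.ncard_le_ncard h (hcard n hn).1).trans (hcard n hn).2
  refine not_finite_quotBy (R := R) (c := 3 / 2) ?_ (fun d s hs => hs.2.1) hfin (by norm_num) ?_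
  · intro s hs
    obtain ⟨n, hn, d, hsd, h1, h2⟩ := hS s hs
    rcases d with _ | d
    · simp at h1
    · exact ⟨d, hs, hsd, n, hn, h1, h2⟩
  · intro N
    calc ∑ d ∈ Finset.range N, ((R d).ncard : ℝ) / (3 / 2) ^ d
        ≤ ∑ d ∈ Finset.range N, 9 / 128 * (3 / 4) ^ d := by
          refine Finset.sum_le_sum fun d _ => ?_
          rw [div_le_iff₀ (by positivity), mul_assoc, ← mul_pow]
          refine (hbound d).trans (le_of_eq ?_)
          rw [pow_succ]
          norm_num
          ring
      _ = 9 / 128 * ((1 - (3 / 4) ^ N) * 4) := by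
          rw [← Finset.mul_sum, geom_sum_eq (by norm_num)]
          ring
      _ ≤ 2 - 3 / 2 := by
          have : (0 : ℝ) ≤ (3 / 4) ^ N := by positivity
          linarith
end
end

section
/- Let α, t, c be natural numbers with 1 ≤ c ≤ α, and let G₁ ⊆ (∑_{i=α}^{α+t} A(i)) ⊗ (∑_{i=c}^{α+t} A(i)) and G₂ ⊆ (∑_{i=c}^{α+t} A(i)) ⊗ (∑_{i=α}^{α+t} A(i)) be K-subspaces of A ⊗_K A. Then there exist K-subspaces T_α(G₁) ⊆ A(α) ⊗ (∑_{i=c}^{α} A(i)) and T_α(G₂) ⊆ (∑_{i=c}^{α} A(i)) ⊗ A(α) such that G₁ ⊆ T_α(G₁)·(∑_{0≤i,j≤t} A(i) ⊗ A(j)) and G₂ ⊆ T_α(G₂)·(∑_{0≤i,j≤t} A(i) ⊗ A(j)), with dim_K T_α(G₁) ≤ 2^{2t+2}·dim_K G₁ and dim_K T_α(G₂) ≤ 2^{2t+2}·dim_K G₂. -/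
open TensorProduct

noncomputable section

/-- `∑_{i=lo}^{hi} A(i)`. -/
def sumGp (K : Type) [Field K] (lo hi : ℕ) : Submodule K (FA K) :=
  ⨆ i ∈ Finset.Icc lo hi, gp K i

/-- `∑_{0 ≤ i, j ≤ t} A(i) ⊗ A(j)`. -/
def Hsp (K : Type) [Field K] (t : ℕ) : Submodule K (FA K ⊗[K] FA K) :=
  ⨆ i ∈ Finset.Iic t, ⨆ j ∈ Finset.Iic t, tp K (gp K i) (gp K j)

/-- The word of `FA K` spelled by a list of letters. -/
def wordFA (K : Type) [Field K] (w : List (Fin 2)) : FA K := (w.map (FreeAlgebra.ι K)).prod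

lemma wordFA_append (K : Type) [Field K] (v w : List (Fin 2)) :
    wordFA K (v ++ w) = wordFA K v * wordFA K w := by
  simp [wordFA]

lemma wordFA_mem_gp (K : Type) [Field K] (w : List (Fin 2)) : wordFA K w ∈ gp K w.length :=
  Submodule.subset_span ⟨w, rfl, rfl⟩

lemma basisFreeMonoid_ofList (K : Type) [Field K] (w : List (Fin 2)) :
    FreeAlgebra.basisFreeMonoid K (Fin 2) (FreeMonoid.ofList w) = wordFA K w := by
  have h : FreeAlgebra.basisFreeMonoid K (Fin 2) (FreeMonoid.ofList w) =
      FreeAlgebra.equivMonoidAlgebraFreeMonoid.symm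
        (MonoidAlgebra.of K (FreeMonoid (Fin 2)) (FreeMonoid.ofList w)) := rfl
  rw [h, AlgEquiv.symm_apply_eq]
  induction w with
  | nil => simp [wordFA, MonoidAlgebra.one_def]
  | cons a w ih =>
    rw [FreeMonoid.ofList_cons, map_mul, ih rfl]
    simp [wordFA, FreeAlgebra.equivMonoidAlgebraFreeMonoid]

/-- The linear map sending a word `w = p v`, where `p` consists of the first `α` letters of `w`
(all of `w` if it is shorter), to `p`, and all other words to `0`. -/
def stripFA (K : Type) [Field K] (α : ℕ) (v : List (Fin 2)) : FA K →ₗ[K] FA K :=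
  (FreeAlgebra.basisFreeMonoid K (Fin 2)).constr K fun w =>
    if w.toList.drop α = v then wordFA K (w.toList.take α) else 0

lemma stripFA_wordFA (K : Type) [Field K] (α : ℕ) (v w : List (Fin 2)) :
    stripFA K α v (wordFA K w) = if w.drop α = v then wordFA K (w.take α) else 0 := by
  rw [← basisFreeMonoid_ofList, stripFA, Module.Basis.constr_basis, FreeMonoid.toList_ofList]

lemma gp_le_sumGp (K : Type) [Field K] {lo hi n : ℕ} (h₁ : lo ≤ n) (h₂ : n ≤ hi) :
    gp K n ≤ sumGp K lo hi :=
  le_iSup₂_of_le n (Finset.mem_Icc.2 ⟨h₁, h₂⟩) le_rfl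

lemma sumGp_self (K : Type) [Field K] (n : ℕ) : sumGp K n n = gp K n := by
  simp [sumGp]

lemma sumGp_le (K : Type) [Field K] {lo hi : ℕ} {S : Submodule K (FA K)}
    (h : ∀ w : List (Fin 2), lo ≤ w.length → w.length ≤ hi → wordFA K w ∈ S) :
    sumGp K lo hi ≤ S := by
  refine iSup₂_le fun n hn => Submodule.span_le.2 ?_
  rintro _ ⟨w, rfl, rfl⟩
  exact h w (Finset.mem_Icc.1 hn).1 (Finset.mem_Icc.1 hn).2

lemma sumGp_fg (K : Type) [Field K] (lo hi : ℕ) : (sumGp K lo hi).FG := by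
  refine Submodule.fg_biSup _ _ fun n _ => Submodule.fg_span ?_
  refine ((List.finite_length_eq (Fin 2) n).image (wordFA K)).subset ?_
  rintro _ ⟨w, hw, rfl⟩
  exact ⟨w, hw, rfl⟩

lemma stripFA_mem (K : Type) [Field K] {lo hi α : ℕ} (h : lo ≤ α) (v : List (Fin 2)) {x : FA K}
    (hx : x ∈ sumGp K lo hi) : stripFA K α v x ∈ sumGp K lo α := by
  refine sumGp_le K (S := (sumGp K lo α).comap (stripFA K α v)) (fun w hw _ => ?_) hx
  rw [Submodule.mem_comap, stripFA_wordFA]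
  split_ifs
  · exact gp_le_sumGp K (by simp [h, hw]) (by simp) (wordFA_mem_gp K _)
  · exact zero_mem _

/-- The lists of at most `t` letters. -/
abbrev ShortList (t : ℕ) : Type := Σ i : Fin (t + 1), List.Vector (Fin 2) i

lemma card_shortList_le (t : ℕ) : Fintype.card (ShortList t) ≤ 2 ^ (t + 1) := by
  have h : Fintype.card (ShortList t) = ∑ i ∈ Finset.range (t + 1), 2 ^ i := by
    simp [Finset.sum_range]
  rw [h, Nat.geomSum_eq le_rfl]
  simp

lemma sum_stripFA_mul (K : Type) [Field K] {lo α t : ℕ} {x : FA K}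
    (hx : x ∈ sumGp K lo (α + t)) :
    ∑ v : ShortList t, stripFA K α v.2.1 x * wordFA K v.2.1 = x := by
  let φ : FA K →ₗ[K] FA K :=
    ∑ v : ShortList t, LinearMap.mulRight K (wordFA K v.2.1) ∘ₗ stripFA K α v.2.1
  suffices h : x ∈ LinearMap.eqLocus φ LinearMap.id by
    simpa [φ] using h
  refine sumGp_le K (fun w _ hw => ?_) hx
  have hlen : (w.drop α).length < t + 1 := by simp; omega
  have key : ∑ v : ShortList t, stripFA K α v.2.1 (wordFA K w) * wordFA K v.2.1 = wordFA K w := by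
    rw [Finset.sum_eq_single (⟨⟨_, hlen⟩, ⟨w.drop α, rfl⟩⟩ : ShortList t)]
    · rw [stripFA_wordFA, if_pos rfl, ← wordFA_append, List.take_append_drop]
    · rintro ⟨⟨i, hi⟩, ⟨v, hv⟩⟩ _ hne
      rw [stripFA_wordFA, if_neg, zero_mul]
      rintro rfl
      dsimp only at hv
      subst hv
      exact hne rfl
    · simp
  simpa [φ] using key

lemma wordFA_tmul_mem_Hsp (K : Type) [Field K] {t : ℕ} {u v : List (Fin 2)}
    (hu : u.length ≤ t) (hv : v.length ≤ t) : wordFA K u ⊗ₜ[K] wordFA K v ∈ Hsp K t := by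
  have h : tp K (gp K u.length) (gp K v.length) ≤ Hsp K t :=
    le_iSup₂_of_le u.length (Finset.mem_Iic.2 hu)
      (le_iSup₂_of_le v.length (Finset.mem_Iic.2 hv) le_rfl)
  exact h (Submodule.apply_mem_map₂ _ (wordFA_mem_gp K u) (wordFA_mem_gp K v))

lemma finrank_iSup_map_le {K V W ι : Type*} [Field K] [AddCommGroup V] [Module K V]
    [AddCommGroup W] [Module K W] [Fintype ι] (f : ι → V →ₗ[K] W) (G : Submodule K V)
    [FiniteDimensional K G] :
    Module.finrank K (⨆ i, G.map (f i) : Submodule K W) ≤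
      Fintype.card ι * Module.finrank K G := by
  classical
  rw [← Finset.sup_univ_eq_iSup, ← Finset.card_univ]
  have key (s : Finset ι) : FiniteDimensional K (s.sup fun i => G.map (f i) : Submodule K W) ∧
      Module.finrank K (s.sup fun i => G.map (f i) : Submodule K W) ≤
        s.card * Module.finrank K G := by
    induction s using Finset.induction_on with
    | empty => exact ⟨by rw [Finset.sup_empty]; infer_instance, by simp⟩
    | insert i s hi ih =>
      obtain ⟨_, ih⟩ := ih
      rw [Finset.sup_insert, Finset.card_insert_of_notMem hi, add_mul, one_mul, add_comm]
      exact ⟨inferInstance, (Submodule.finrank_add_le_finrank_add_finrank _ _).trans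
        (add_le_add (Submodule.finrank_map_le (f i) G) ih)⟩
  exact (key _).2

/-- Truncating both tensor factors of `G` to their first `α` letters. -/
lemma exists_truncation (K : Type) [Field K] {α t a b : ℕ} (ha : a ≤ α) (hb : b ≤ α)
    (G : Submodule K (FA K ⊗[K] FA K))
    (hG : G ≤ tp K (sumGp K a (α + t)) (sumGp K b (α + t))) :
    ∃ T : Submodule K (FA K ⊗[K] FA K),
      T ≤ tp K (sumGp K a α) (sumGp K b α) ∧ G ≤ T * Hsp K t ∧
      Module.finrank K T ≤ 2 ^ (2 * t + 2) * Module.finrank K G := by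
  have hfg : (tp K (sumGp K a (α + t)) (sumGp K b (α + t))).FG :=
    (sumGp_fg K a (α + t)).map₂ _ (sumGp_fg K b (α + t))
  have : FiniteDimensional K (tp K (sumGp K a (α + t)) (sumGp K b (α + t))) :=
    Module.Finite.iff_fg.2 hfg
  have : FiniteDimensional K G := Submodule.finiteDimensional_of_le hG
  let F (p : ShortList t × ShortList t) : FA K ⊗[K] FA K →ₗ[K] FA K ⊗[K] FA K :=
    TensorProduct.map (stripFA K α p.1.2.1) (stripFA K α p.2.2.1)
  refine ⟨⨆ p, G.map (F p), iSup_le fun p => ?_, fun g hg => ?_, ?_⟩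
  · refine Submodule.map_le_iff_le_comap.2 (hG.trans (Submodule.map₂_le.2 fun x hx y hy => ?_))
    exact Submodule.apply_mem_map₂ _ (stripFA_mem K ha _ hx) (stripFA_mem K hb _ hy)
  · let e (p : ShortList t × ShortList t) : FA K ⊗[K] FA K :=
      wordFA K p.1.2.1 ⊗ₜ wordFA K p.2.2.1
    let φ : FA K ⊗[K] FA K →ₗ[K] FA K ⊗[K] FA K := ∑ p, LinearMap.mulRight K (e p) ∘ₗ F p
    have h : tp K (sumGp K a (α + t)) (sumGp K b (α + t)) ≤
        LinearMap.eqLocus φ LinearMap.id := by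
      refine Submodule.map₂_le.2 fun x hx y hy => ?_
      have key : ∑ p, F p (x ⊗ₜ y) * e p = x ⊗ₜ y := by
        simp only [F, e, TensorProduct.map_tmul, Algebra.TensorProduct.tmul_mul_tmul]
        rw [Fintype.sum_prod_type]
        simp only [← TensorProduct.tmul_sum, ← TensorProduct.sum_tmul, sum_stripFA_mul K hx,
          sum_stripFA_mul K hy]
      simpa [φ] using key
    have hφ : ∑ p, F p g * e p = g := by simpa [φ] using h (hG hg)
    rw [← hφ]
    refine Submodule.sum_mem _ fun p _ => Submodule.mul_mem_mul
      (Submodule.mem_iSup_of_mem p (Submodule.mem_map_of_mem hg)) (wordFA_tmul_mem_Hsp K ?_ ?_)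
    · exact p.1.2.2.trans_le (Nat.lt_succ_iff.1 p.1.1.2)
    · exact p.2.2.2.trans_le (Nat.lt_succ_iff.1 p.2.1.2)
  · refine (finrank_iSup_map_le F G).trans (Nat.mul_le_mul_right _ ?_)
    rw [Fintype.card_prod, show 2 * t + 2 = (t + 1) + (t + 1) by ring, pow_add]
    exact Nat.mul_le_mul (card_shortList_le t) (card_shortList_le t)

theorem statement8 (K : Type) [Field K] (α t c : ℕ) (hc₁ : 1 ≤ c) (hc₂ : c ≤ α)
    (G₁ G₂ : Submodule K (FA K ⊗[K] FA K))
    (hG₁ : G₁ ≤ tp K (sumGp K α (α + t)) (sumGp K c (α + t)))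
    (hG₂ : G₂ ≤ tp K (sumGp K c (α + t)) (sumGp K α (α + t))) :
    ∃ T₁ T₂ : Submodule K (FA K ⊗[K] FA K),
      T₁ ≤ tp K (gp K α) (sumGp K c α) ∧
      T₂ ≤ tp K (sumGp K c α) (gp K α) ∧
      G₁ ≤ T₁ * Hsp K t ∧
      G₂ ≤ T₂ * Hsp K t ∧
      Module.finrank K T₁ ≤ 2 ^ (2 * t + 2) * Module.finrank K G₁ ∧
      Module.finrank K T₂ ≤ 2 ^ (2 * t + 2) * Module.finrank K G₂ := by
  obtain ⟨T₁, h₁, h₁', h₁''⟩ := exists_truncation K le_rfl hc₂ G₁ hG₁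
  obtain ⟨T₂, h₂, h₂', h₂''⟩ := exists_truncation K hc₂ le_rfl G₂ hG₂
  rw [sumGp_self] at h₁ h₂
  exact ⟨T₁, T₂, h₁, h₂, h₁', h₂', h₁'', h₂''⟩
end
end

section
/- Let t ≥ 1 and let f ∈ ∑_{1≤i,j≤t} A(i) ⊗ A(j) ⊆ A ⊗_K A. For each natural number n ≥ t there exists a K-subspace F ⊆ A(n) ⊗ A with dim_K F < 2^{2t+1}·t·n such that, for every integer m ≥ n, f^m belongs to the right ideal of A ⊗_K A generated by the set of all products h·g·f^{m−n} with h ∈ F and g ∈ (∑_{i=0}^{t} A(i)) ⊗ K·1. -/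
open TensorProduct

noncomputable section

/-- The right ideal of `A ⊗[K] A` generated by a set `X`: the span of `X·(A ⊗ A)`. -/
def rIdeal (K : Type) [Field K] (X : Set (FA K ⊗[K] FA K)) :
    Submodule K (FA K ⊗[K] FA K) :=
  Submodule.span K X * ⊤

/-- The product of the generators listed in `w`. -/
def wordProd (K : Type) [Field K] (w : List (Fin 2)) : FA K :=
  (w.map (FreeAlgebra.ι K)).prod

theorem wordProd_append (K : Type) [Field K] (v w : List (Fin 2)) :
    wordProd K (v ++ w) = wordProd K v * wordProd K w := by
  simp [wordProd]

theorem wordProd_mem_gp (K : Type) [Field K] (w : List (Fin 2)) :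
    wordProd K w ∈ gp K w.length :=
  Submodule.subset_span ⟨w, rfl, rfl⟩

theorem one_mem_gp_zero (K : Type) [Field K] : (1 : FA K) ∈ gp K 0 :=
  wordProd_mem_gp K []

theorem gp_mul_gp_le (K : Type) [Field K] (i j : ℕ) : gp K i * gp K j ≤ gp K (i + j) := by
  rw [gp, gp, Submodule.span_mul_span, Submodule.span_le]
  rintro _ ⟨_, ⟨v, rfl, rfl⟩, _, ⟨w, rfl, rfl⟩, rfl⟩
  have h := wordProd_mem_gp K (v ++ w)
  rwa [List.length_append, wordProd_append] at h

theorem tmul_mem_tp {K : Type} [Field K] {U V : Submodule K (FA K)} {a b : FA K}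
    (ha : a ∈ U) (hb : b ∈ V) : a ⊗ₜ[K] b ∈ tp K U V :=
  Submodule.apply_mem_map₂ (TensorProduct.mk K (FA K) (FA K)) ha hb

theorem tp_mul_tp_le (K : Type) [Field K] (U V U' V' : Submodule K (FA K)) :
    tp K U V * tp K U' V' ≤ tp K (U * U') (V * V') := by
  conv_lhs => rw [tp, tp, Submodule.map₂_eq_span_image2, Submodule.map₂_eq_span_image2,
    Submodule.span_mul_span]
  rw [Submodule.span_le]
  rintro _ ⟨_, ⟨a, ha, b, hb, rfl⟩, _, ⟨c, hc, d, hd, rfl⟩, rfl⟩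
  simp only [TensorProduct.mk_apply, Algebra.TensorProduct.tmul_mul_tmul]
  exact tmul_mem_tp (Submodule.mul_mem_mul ha hc) (Submodule.mul_mem_mul hb hd)

/-- The elements of `A ⊗ A` whose first tensor factors have degrees in `[a, b)`. -/
def leftDeg (K : Type) [Field K] (a b : ℕ) : Submodule K (FA K ⊗[K] FA K) :=
  ⨆ d ∈ Finset.Ico a b, tp K (gp K d) ⊤

theorem tp_le_leftDeg (K : Type) [Field K] {a b d : ℕ} (had : a ≤ d) (hdb : d < b) :
    tp K (gp K d) ⊤ ≤ leftDeg K a b :=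
  le_iSup₂_of_le d (Finset.mem_Ico.2 ⟨had, hdb⟩) le_rfl

theorem leftDeg_mul_leftDeg_le (K : Type) [Field K] (k n t : ℕ) :
    leftDeg K k n * leftDeg K 1 (t + 1) ≤ leftDeg K (k + 1) n ⊔ leftDeg K n (n + t) := by
  unfold leftDeg
  simp only [Submodule.iSup_mul, Submodule.mul_iSup]
  refine iSup₂_le fun j hj => iSup₂_le fun i hi => ?_
  rw [Finset.mem_Ico] at hi hj
  refine (tp_mul_tp_le K _ _ _ _).trans
    ((Submodule.map₂_le_map₂ (gp_mul_gp_le K _ _) le_top).trans ?_)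
  rcases lt_or_ge (i + j) n with h | h
  · exact (tp_le_leftDeg K (b := n) (d := i + j) (by omega) h).trans le_sup_left
  · exact (tp_le_leftDeg K (b := n + t) (d := i + j) h (by omega)).trans le_sup_right

/-- Expand `f ^ k`, cutting every monomial as soon as its left degree reaches `n`. -/
theorem exists_pow_eq_add_sum {K : Type} [Field K] {t n : ℕ} (hn : 0 < n)
    {f : FA K ⊗[K] FA K} (hf : f ∈ leftDeg K 1 (t + 1)) (k : ℕ) :
    ∃ r ∈ leftDeg K k n, ∃ p : ℕ → FA K ⊗[K] FA K, (∀ j, p j ∈ leftDeg K n (n + t)) ∧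
      f ^ k = r + ∑ j ∈ Finset.range k, p j * f ^ (k - 1 - j) := by
  induction k with
  | zero =>
    refine ⟨1, tp_le_leftDeg K le_rfl hn (tmul_mem_tp (one_mem_gp_zero K) trivial),
      0, fun _ => zero_mem _, by simp⟩
  | succ k ih =>
    obtain ⟨r, hr, p, hp, hpow⟩ := ih
    obtain ⟨r', hr', q, hq, hrq⟩ := Submodule.mem_sup.1
      (leftDeg_mul_leftDeg_le K k n t (Submodule.mul_mem_mul hr hf))
    refine ⟨r', hr', fun j => if j = k then q else p j, fun j => ?_, ?_⟩
    · dsimp only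
      split_ifs
      exacts [hq, hp j]
    · rw [pow_succ, hpow, add_mul, ← hrq, Finset.sum_range_succ, Finset.sum_mul, add_assoc,
        add_comm q]
      congr 2
      · refine Finset.sum_congr rfl fun j hj => ?_
        rw [Finset.mem_range] at hj
        dsimp only
        rw [if_neg hj.ne, mul_assoc, ← pow_succ]
        congr 2
        omega
      · simp

/-- Words of length less than `t`. -/
abbrev ShortWord (t : ℕ) : Type := Σ e : Fin t, (Fin e → Fin 2)

theorem card_shortWord_lt (t : ℕ) : Fintype.card (ShortWord t) < 2 ^ t := by
  simp only [Fintype.card_sigma, Fintype.card_fun, Fintype.card_fin]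
  rw [Fin.sum_univ_eq_sum_range (fun e => 2 ^ e)]
  exact Nat.geomSum_lt le_rfl (by simp)

theorem exists_eq_sum_mul_shortWord {K : Type} [Field K] {n t : ℕ} {z : FA K ⊗[K] FA K}
    (hz : z ∈ leftDeg K n (n + t)) :
    ∃ h : ShortWord t → FA K ⊗[K] FA K, (∀ w, h w ∈ tp K (gp K n) ⊤) ∧
      z = ∑ w, h w * (wordProd K (List.ofFn w.2) ⊗ₜ[K] 1) := by
  have key : leftDeg K n (n + t) ≤ ⨆ w : ShortWord t, (tp K (gp K n) ⊤).map
      (LinearMap.mulRight K (wordProd K (List.ofFn w.2) ⊗ₜ[K] (1 : FA K))) := by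
    refine iSup₂_le fun d hd => Submodule.map₂_le.2 fun a ha b _ => ?_
    rw [Finset.mem_Ico] at hd
    refine Submodule.span_induction (p := fun a _ => TensorProduct.mk K (FA K) (FA K) a b ∈ _)
      ?_ (by simp) (fun x y _ _ hx hy => ?_) (fun c x _ hx => ?_) ha
    · rintro _ ⟨w, rfl, rfl⟩
      have hlen : (w.drop n).length < t := by rw [List.length_drop]; omega
      refine Submodule.mem_iSup_of_mem ⟨⟨_, hlen⟩, (w.drop n).get⟩
        ⟨wordProd K (w.take n) ⊗ₜ b, tmul_mem_tp ?_ trivial, ?_⟩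
      · have h := wordProd_mem_gp K (w.take n)
        rwa [List.length_take, min_eq_left hd.1] at h
      · simp only [LinearMap.mulRight_apply, Algebra.TensorProduct.tmul_mul_tmul, mul_one,
          List.ofFn_get, ← wordProd_append, List.take_append_drop]
        rfl
    · simpa only [map_add, LinearMap.add_apply] using add_mem hx hy
    · simpa only [map_smul, LinearMap.smul_apply] using Submodule.smul_mem _ c hx
  obtain ⟨y, hy⟩ := (Submodule.mem_iSup_iff_exists_finsupp _ _).1 (key hz)
  choose h hmem hmul using hy.1
  refine ⟨h, hmem, ?_⟩
  rw [← hy.2, Finsupp.sum_fintype _ _ fun _ => rfl]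
  exact Finset.sum_congr rfl fun w _ => (hmul w).symm

theorem shortWord_mem_tp (K : Type) [Field K] {t : ℕ} (w : ShortWord t) :
    wordProd K (List.ofFn w.2) ⊗ₜ[K] 1 ∈ tp K (sumGp K 0 t) (gp K 0) := by
  refine tmul_mem_tp ?_ (one_mem_gp_zero K)
  have h := wordProd_mem_gp K (List.ofFn w.2)
  rw [List.length_ofFn] at h
  exact Submodule.mem_iSup_of_mem (w.1 : ℕ) (Submodule.mem_iSup_of_mem (by simp) h)

theorem statement9 (K : Type) [Field K] (t : ℕ) (ht : 1 ≤ t)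
    (f : FA K ⊗[K] FA K)
    (hf : f ∈ ⨆ i ∈ Finset.Icc 1 t, ⨆ j ∈ Finset.Icc 1 t, tp K (gp K i) (gp K j))
    (n : ℕ) (hn : t ≤ n) :
    ∃ F : Submodule K (FA K ⊗[K] FA K),
      F ≤ tp K (gp K n) ⊤ ∧
      FiniteDimensional K F ∧
      Module.finrank K F < 2 ^ (2 * t + 1) * t * n ∧
      ∀ m : ℕ, n ≤ m →
        f ^ m ∈ rIdeal K
          {z | ∃ h ∈ F, ∃ g ∈ tp K (sumGp K 0 t) (gp K 0), z = h * g * f ^ (m - n)} := by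
  have hf' : f ∈ leftDeg K 1 (t + 1) := by
    refine (iSup₂_le fun i hi => iSup₂_le fun j _ => ?_ :
      (⨆ i ∈ Finset.Icc 1 t, ⨆ j ∈ Finset.Icc 1 t, tp K (gp K i) (gp K j)) ≤ _) hf
    rw [Finset.mem_Icc] at hi
    exact (Submodule.map₂_le_map₂ le_rfl le_top).trans
      (tp_le_leftDeg K hi.1 (Nat.lt_succ_of_le hi.2))
  have hn0 : 0 < n := by omega
  obtain ⟨r, hr, p, hp, hpow⟩ := exists_pow_eq_add_sum hn0 hf' n
  obtain rfl : r = 0 := by simpa [leftDeg] using hr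
  rw [zero_add] at hpow
  choose h hmem hsum using fun j => exists_eq_sum_mul_shortWord (hp j)
  let v : Fin n × ShortWord t → FA K ⊗[K] FA K := fun i => h i.1 i.2
  refine ⟨Submodule.span K (Set.range v), ?_, FiniteDimensional.span_of_finite K
    (Set.finite_range v), ?_, fun m hm => ?_⟩
  · rw [Submodule.span_le]
    rintro _ ⟨i, rfl⟩
    exact hmem _ _
  · calc Module.finrank K (Submodule.span K (Set.range v))
        ≤ Fintype.card (Fin n × ShortWord t) := finrank_range_le_card v
      _ = Fintype.card (ShortWord t) * n := by
        rw [Fintype.card_prod, Fintype.card_fin, mul_comm]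
      _ < 2 ^ t * n := Nat.mul_lt_mul_of_pos_right (card_shortWord_lt t) hn0
      _ ≤ 2 ^ (2 * t + 1) * t * n := by
        refine Nat.mul_le_mul_right n ((Nat.pow_le_pow_right two_pos (by omega)).trans
          (Nat.le_mul_of_pos_right _ ht))
  · have hfm : f ^ m = ∑ j ∈ Finset.range n, p j * f ^ (m - n) * f ^ (n - 1 - j) := by
      rw [← Nat.add_sub_cancel' hm, pow_add, hpow, Finset.sum_mul, Nat.add_sub_cancel_left]
      refine Finset.sum_congr rfl fun j _ => ?_
      rw [mul_assoc, mul_assoc, (Commute.refl f).pow_pow]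
    rw [hfm]
    refine Submodule.sum_mem _ fun j hj => Submodule.mul_mem_mul ?_ Submodule.mem_top
    rw [hsum j, Finset.sum_mul]
    exact Submodule.sum_mem _ fun w _ => Submodule.subset_span
      ⟨h j w, Submodule.subset_span ⟨(⟨j, Finset.mem_range.1 hj⟩, w), rfl⟩, _,
        shortWord_mem_tp K w, rfl⟩
end
end

section
/- Let N ≥ 1 be a natural number and let C ⊆ D be K-subspaces of A = K⟨x,y⟩ such that A(N)·C ⊆ C. Define I[D] = { r ∈ D : A·r ⊆ D }. If a ∈ ⋂_{i=0}^{N} A(i)·C (where A(0)·C = C), then a ∈ I[D], i.e. a ∈ D and v·a ∈ D for every v ∈ A. -/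
open TensorProduct

noncomputable section

theorem gp_mul_gp (K : Type) [Field K] (m n : ℕ) : gp K m * gp K n = gp K (m + n) := by
  rw [gp, gp, gp, Submodule.span_mul_span]
  congr 1
  ext a
  simp only [Set.mem_mul, Set.mem_ofPred_eq]
  constructor
  · rintro ⟨_, ⟨u, rfl, rfl⟩, _, ⟨v, rfl, rfl⟩, rfl⟩
    exact ⟨u ++ v, by simp, by simp⟩
  · rintro ⟨w, hw, rfl⟩
    refine ⟨_, ⟨w.take m, by simp [hw], rfl⟩, _, ⟨w.drop m, by simp [hw], rfl⟩, ?_⟩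
    rw [← List.prod_append, ← List.map_append, List.take_append_drop]

theorem gp_mul_le_of_dvd {K : Type} [Field K] {N : ℕ} {C : Submodule K (FA K)}
    (hC : gp K N * C ≤ C) (k : ℕ) : gp K (N * k) * C ≤ C := by
  induction k with
  | zero =>
    have h : gp K 0 ≤ 1 := by
      rw [gp, Submodule.span_le]
      rintro _ ⟨w, hw, rfl⟩
      simp [List.length_eq_zero_iff.mp hw]
    simpa using mul_le_mul_left h C
  | succ k ih =>
    rw [Nat.mul_succ, ← gp_mul_gp, mul_assoc]
    exact (mul_le_mul_right hC _).trans ih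

theorem span_words_eq_top (K : Type) [Field K] :
    Submodule.span K (Set.range fun w : List (Fin 2) => (w.map (FreeAlgebra.ι K)).prod) = ⊤ := by
  rw [← Algebra.top_toSubmodule, ← FreeAlgebra.adjoin_range_ι, Algebra.adjoin_eq_span]
  congr 1
  ext a
  rw [← FreeMonoid.mrange_lift, MonoidHom.coe_mrange, Set.mem_range, Set.mem_range]
  simp only [FreeMonoid.lift_apply]
  exact FreeMonoid.toList.surjective.exists

theorem statement18 (K : Type) [Field K] (N : ℕ) (hN : 1 ≤ N)
    (C D : Submodule K (FA K)) (hCD : C ≤ D)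
    (hC : gp K N * C ≤ C)
    (a : FA K) (ha : a ∈ ⨅ i ∈ Set.Iic N, gp K i * C) :
    a ∈ D ∧ ∀ v : FA K, v * a ∈ D := by
  have h : ∀ v : FA K, v * a ∈ D := by
    intro v
    have hv : v ∈ Submodule.span K
        (Set.range fun w : List (Fin 2) => (w.map (FreeAlgebra.ι K)).prod) := by
      rw [span_words_eq_top]
      trivial
    induction hv using Submodule.span_induction with
    | zero => simp
    | add u v _ _ hu hv => rw [add_mul]; exact D.add_mem hu hv
    | smul c v _ hv => rw [smul_mul_assoc]; exact D.smul_mem c hv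
    | mem v hv =>
      obtain ⟨w, rfl⟩ := hv
      have hw : (w.map (FreeAlgebra.ι K)).prod ∈ gp K w.length :=
        Submodule.subset_span ⟨w, rfl, rfl⟩
      have hai : a ∈ gp K (N - w.length % N) * C := by
        simp only [Submodule.mem_iInf] at ha
        exact ha _ (Nat.sub_le _ _)
      have hlen : w.length + (N - w.length % N) = N * (w.length / N + 1) := by
        have h₁ := Nat.div_add_mod w.length N
        have h₂ := Nat.mod_lt w.length hN
        rw [Nat.mul_succ]
        omega
      have hmul := Submodule.mul_mem_mul hw hai
      rw [← mul_assoc, gp_mul_gp, hlen] at hmul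
      exact hCD (gp_mul_le_of_dvd hC _ hmul)
  exact ⟨by simpa using h 1, h⟩
end
end
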